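/- The matrices f_j^± := c_j^± for j = 1,…,m satisfy the parafermion triple relations: for all j, k, l ∈ {1,…,m} and all ξ, η, ε ∈ {+1,−1}, [[f_j^ξ, f_k^η], f_l^ε] = ½(ε−η)² δ_{kl} f_j^ξ − ½(ε−ξ)² δ_{jl} f_k^η, where [·,·] denotes the ordinary matrix commutator and ξ, η, ε are interpreted as the integers ±1 in the expressions (ε−η) and (ε−ξ). -/

import Mathlib

/- Setup: the parafermion generators `f_j^± = c_j^±` (j = 1,…,m) of
osp(2m+1|2n) realized as matrices. -/

noncomputable section

/-- `matE m n i j` is the `N×N` complex matrix (`N = 2m+2n+1`) with a `1` in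
(1-based) position `(i,j)` and zeros elsewhere. -/
def matE (m n : ℕ) (i j : ℕ) : Matrix (Fin (2*m+2*n+1)) (Fin (2*m+2*n+1)) ℂ :=
  Matrix.of fun a b => if a.val + 1 = i ∧ b.val + 1 = j then 1 else 0

/-- The parafermion generators `f_j^s` (1-based `j ∈ {1,…,m}`, sign `s ∈ {1,-1}`):
`f_j^+ = √2(e_{j,2m+1} - e_{2m+1,j+m})`, `f_j^- = √2(e_{2m+1,j} - e_{j+m,2m+1})`. -/
def fgen (m n : ℕ) (j : ℕ) (s : ℤ) : Matrix (Fin (2*m+2*n+1)) (Fin (2*m+2*n+1)) ℂ :=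
  if s = 1 then
    (Real.sqrt 2 : ℂ) • (matE m n j (2*m+1) - matE m n (2*m+1) (j+m))
  else
    (Real.sqrt 2 : ℂ) • (matE m n (2*m+1) j - matE m n (j+m) (2*m+1))

theorem matE_mul (m n i j k l : ℕ) (h1 : 1 ≤ j) (h2 : j ≤ 2*m+2*n+1) :
    matE m n i j * matE m n k l = if j = k then matE m n i l else 0 := by
  ext a b
  rw [Matrix.mul_apply, Finset.sum_eq_single (⟨j-1, by omega⟩ : Fin (2*m+2*n+1))]
  · have : j - 1 + 1 = j := by omega
    by_cases hjk : j = k <;> simp [matE, this, hjk] 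
    split_ifs <;> simp_all
  · intro c _ hc
    have : c.val + 1 ≠ j := by
      intro h
      apply hc
      ext
      simp
      omega
    simp [matE, this]
  · simp

/-- the unsigned generator -/
def xgen (m n a a' : ℕ) : Matrix (Fin (2*m+2*n+1)) (Fin (2*m+2*n+1)) ℂ :=
  matE m n a (2*m+1) - matE m n (2*m+1) a'

theorem xgen_triple (m n a a' b b' c c' : ℕ)
    (ha : 1 ≤ a ∧ a ≤ 2*m) (ha' : 1 ≤ a' ∧ a' ≤ 2*m)
    (hb : 1 ≤ b ∧ b ≤ 2*m) (hb' : 1 ≤ b' ∧ b' ≤ 2*m)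
    (hc : 1 ≤ c ∧ c ≤ 2*m) (hc' : 1 ≤ c' ∧ c' ≤ 2*m)
    (hab : a' = b ↔ b' = a) (hac : c' = a ↔ a' = c) (hbc : c' = b ↔ b' = c) :
    (xgen m n a a' * xgen m n b b' - xgen m n b b' * xgen m n a a') * xgen m n c c'
      - xgen m n c c' * (xgen m n a a' * xgen m n b b' - xgen m n b b' * xgen m n a a')
    = (if a' = c then (1:ℂ) else 0) • xgen m n b b'
      - (if b' = c then (1:ℂ) else 0) • xgen m n a a' := by
  have key : xgen m n a a' * xgen m n b b' - xgen m n b b' * xgen m n a a'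
      = matE m n b a' - matE m n a b' := by
    simp only [xgen, mul_sub, sub_mul]
    repeat rw [matE_mul _ _ _ _ _ _ (by omega) (by omega)]
    have e1 : 2*m+1 ≠ a := by omega
    have e2 : 2*m+1 ≠ b := by omega
    have e3 : a' ≠ 2*m+1 := by omega
    have e4 : b' ≠ 2*m+1 := by omega
    simp only [e1, e2, e3, e4, hab, if_true, if_false]
    abel
  rw [key]
  simp only [xgen, mul_sub, sub_mul]
  repeat rw [matE_mul _ _ _ _ _ _ (by omega) (by omega)]
  have e1 : 2*m+1 ≠ a := by omega
  have e2 : 2*m+1 ≠ b := by omega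
  have e3 : a' ≠ 2*m+1 := by omega
  have e4 : b' ≠ 2*m+1 := by omega
  simp only [e1, e2, e3, e4, hac, hbc, if_false]
  split_ifs <;> simp <;> abel

theorem fgen_pos (m n j : ℕ) : fgen m n j 1 = (Real.sqrt 2 : ℂ) • xgen m n j (j+m) := by
  simp [fgen, xgen]

theorem fgen_neg (m n j : ℕ) : fgen m n j (-1) = (-(Real.sqrt 2 : ℂ)) • xgen m n (j+m) j := by
  have : ¬ ((-1 : ℤ) = 1) := by decide
  simp only [fgen, xgen, this, if_false, neg_smul, ← smul_neg, neg_sub]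

theorem smul_triple {N : ℕ} (A B C : Matrix (Fin N) (Fin N) ℂ) (x y z : ℂ) :
    ((x • A) * (y • B) - (y • B) * (x • A)) * (z • C)
      - (z • C) * ((x • A) * (y • B) - (y • B) * (x • A))
    = (x * y * z) • ((A * B - B * A) * C - C * (A * B - B * A)) := by
  simp only [smul_mul_assoc, mul_smul_comm, sub_mul, mul_sub, smul_sub, smul_smul, mul_assoc]
  simp only [mul_comm, mul_left_comm]

/-- the parafermion triple relations
`[[f_j^ξ, f_k^η], f_l^ε] = ½(ε-η)² δ_{kl} f_j^ξ - ½(ε-ξ)² δ_{jl} f_k^η`. -/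
theorem parafermion_triple_relations (m n : ℕ) (hm : 0 < m) (hn : 0 < n)
    (j k l : ℕ) (hj : j ∈ Finset.Icc 1 m) (hk : k ∈ Finset.Icc 1 m)
    (hl : l ∈ Finset.Icc 1 m)
    (ξ η ε : ℤ) (hξ : ξ = 1 ∨ ξ = -1) (hη : η = 1 ∨ η = -1) (hε : ε = 1 ∨ ε = -1) :
    (fgen m n j ξ * fgen m n k η - fgen m n k η * fgen m n j ξ) * fgen m n l ε
      - fgen m n l ε * (fgen m n j ξ * fgen m n k η - fgen m n k η * fgen m n j ξ)
    = ((1/2 : ℂ) * (((ε - η : ℤ) : ℂ))^2 * (if k = l then 1 else 0)) • fgen m n j ξ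
      - ((1/2 : ℂ) * (((ε - ξ : ℤ) : ℂ))^2 * (if j = l then 1 else 0)) • fgen m n k η := by
  rw [Finset.mem_Icc] at hj hk hl
  have h2 : (Real.sqrt 2 : ℂ) * (Real.sqrt 2 : ℂ) = 2 := by
    rw [← Complex.ofReal_mul, Real.mul_self_sqrt (by norm_num)]
    norm_num
  rcases hξ with rfl | rfl <;> rcases hη with rfl | rfl <;> rcases hε with rfl | rfl <;>
  · simp only [fgen_pos, fgen_neg]
    rw [smul_triple, xgen_triple _ _ _ _ _ _ _ _ (by omega) (by omega) (by omega) (by omega)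
      (by omega) (by omega) (by omega) (by omega) (by omega)]
    have n1 : j ≠ l + m := by omega
    have n2 : k ≠ l + m := by omega
    have n3 : j + m ≠ l := by omega
    have n4 : k + m ≠ l := by omega
    simp only [n1, n2, n3, n4, if_false, Nat.add_right_cancel_iff, smul_sub, smul_smul, h2,
      neg_mul, mul_neg, neg_neg]
    push_cast
    split_ifs <;> norm_num <;> module

end
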